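/- (Godini) Let X be a real normed linear space, M ⊆ X a closed subspace, and r : X → X/M the quotient mapping. Then the following conditions are equivalent: (1) r(B_X) = B_{X/M}; (2) r(B_X) is closed in X/M; (3) M is proximinal in X. -/

import Mathlib

open Filter Topology ENNReal

noncomputable section

/-- The closed ideal `N_U ⊆ ℓ∞(E)` of bounded families whose norms tend to zero along the
ultrafilter `U`.  Here `ℓ∞(E)` is realized as `lp (fun _ : I => E) ∞`, the space of bounded
families in `E` with the supremum norm. -/
def NU {I : Type*} (E : Type*) [NormedAddCommGroup E] [NormedSpace ℝ E] (U : Ultrafilter I) :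
    Submodule ℝ (lp (fun _ : I => E) ∞) where
  carrier := {f | Filter.Tendsto (fun i => ‖f i‖) (U : Filter I) (nhds 0)}
  zero_mem' := by
    simp only [Set.mem_setOf_eq, lp.coeFn_zero, Pi.zero_apply, norm_zero]
    exact tendsto_const_nhds
  add_mem' := by
    intro f g hf hg
    simp only [Set.mem_setOf_eq] at *
    refine squeeze_zero (fun i => norm_nonneg _) (fun i => ?_) (by simpa using hf.add hg)
    have : (↑(f + g) : ∀ _ : I, E) i = f i + g i := by
      simp [lp.coeFn_add]
    rw [this]
    exact norm_add_le _ _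
  smul_mem' := by
    intro c f hf
    simp only [Set.mem_setOf_eq] at *
    have h := hf.const_mul ‖c‖
    rw [mul_zero] at h
    refine squeeze_zero (fun i => norm_nonneg _) (fun i => ?_) h
    have : (↑(c • f) : ∀ _ : I, E) i = c • f i := by
      simp [lp.coeFn_smul]
    rw [this, norm_smul]

/-- The Banach space ultrapower `ℓ∞(E)/N_U` of `E` with respect to the ultrafilter `U`. -/
abbrev Ultrapower {I : Type*} (E : Type*) [NormedAddCommGroup E] [NormedSpace ℝ E]
    (U : Ultrafilter I) : Type _ :=
  (lp (fun _ : I => E) ∞) ⧸ NU E U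

/-- A (semi)normed space is reflexive if the canonical embedding into its bidual is
surjective (it is always an isometry). -/
def IsReflexiveSpace (X : Type*) [SeminormedAddCommGroup X] [NormedSpace ℝ X] : Prop :=
  Function.Surjective (NormedSpace.inclusionInDoubleDual ℝ X)

/-- A Banach space is superreflexive if every Banach space ultrapower of it is reflexive. -/
def SuperReflexive (E : Type*) [NormedAddCommGroup E] [NormedSpace ℝ E] : Prop :=
  ∀ (I : Type) (U : Ultrafilter I), IsReflexiveSpace (Ultrapower E U)

/-- The Stone–Čech remainder `ω* = βω \ ω`, realized inside the space `Ultrafilter ℕ`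
(which is the Stone–Čech compactification `βω` of the discrete space `ω = ℕ`) as the set
of free (non-principal) ultrafilters. -/
def omegaStar : Set (Ultrafilter ℕ) := {p | ∀ n : ℕ, p ≠ pure n}

/-- `C(βω)`: the Banach space of continuous bounded real-valued functions on the
Stone–Čech compactification `βω` of the discrete space `ω = ℕ`, with the sup norm. -/
abbrev CbetaOmega : Type := BoundedContinuousFunction (Ultrafilter ℕ) ℝ

/-- `C(ω*)`: the Banach space of continuous bounded real-valued functions on the
Stone–Čech remainder `ω* = βω \ ω`, with the sup norm. -/
abbrev ComegaStar : Type := BoundedContinuousFunction (↥omegaStar) ℝ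

/-- The quotient norm of the class of `x` is the distance from `x` to the subspace. -/
theorem Submodule.norm_mkQ_eq_infDist {X : Type*} [SeminormedAddCommGroup X] [NormedSpace ℝ X]
    (M : Submodule ℝ X) (x : X) : ‖M.mkQ x‖ = Metric.infDist x (M : Set X) :=
  QuotientAddGroup.norm_mk (S := M.toAddSubgroup) x

/-- The quotient map sends the closed unit ball into the closed unit ball. -/
theorem Submodule.mkQ_image_closedBall_subset {X : Type*} [SeminormedAddCommGroup X]
    [NormedSpace ℝ X] (M : Submodule ℝ X) :
    M.mkQ '' Metric.closedBall (0 : X) 1 ⊆ Metric.closedBall (0 : X ⧸ M) 1 := by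
  rintro _ ⟨x, hx, rfl⟩
  rw [mem_closedBall_zero_iff] at hx ⊢
  exact (Submodule.Quotient.norm_mk_le M x).trans hx

/-- The image of the closed unit ball under the quotient map contains the open unit ball. -/
theorem Submodule.ball_subset_mkQ_image_closedBall {X : Type*} [SeminormedAddCommGroup X]
    [NormedSpace ℝ X] (M : Submodule ℝ X) :
    Metric.ball (0 : X ⧸ M) 1 ⊆ M.mkQ '' Metric.closedBall (0 : X) 1 := by
  intro q hq
  rw [mem_ball_zero_iff] at hq
  obtain ⟨x, rfl, hx⟩ := Submodule.Quotient.norm_mk_lt q (sub_pos.mpr hq)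
  refine ⟨x, ?_, rfl⟩
  rw [mem_closedBall_zero_iff]
  linarith

/-- **Godini.** For a real normed space `X`, a closed subspace `M` and the
quotient map `r : X → X/M`, the following are equivalent: (1) `r(B_X) = B_{X/M}`;
(2) `r(B_X)` is closed in `X/M`; (3) `M` is proximinal in `X`. -/
theorem godini_tfae (X : Type) [NormedAddCommGroup X] [NormedSpace ℝ X]
    (M : Submodule ℝ X) (hM : IsClosed (M : Set X)) :
    List.TFAE
      [M.mkQ '' Metric.closedBall (0 : X) 1 = Metric.closedBall (0 : X ⧸ M) 1,
       IsClosed (M.mkQ '' Metric.closedBall (0 : X) 1),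
       ∀ x : X, ∃ y ∈ M, ‖x - y‖ = Metric.infDist x (M : Set X)] := by
  tfae_have 1 → 2 := fun h => h ▸ Metric.isClosed_closedBall
  tfae_have 2 → 1 := fun h => by
    refine M.mkQ_image_closedBall_subset.antisymm ?_
    rw [← closure_ball (0 : X ⧸ M) one_ne_zero]
    exact closure_minimal M.ball_subset_mkQ_image_closedBall h
  tfae_have 1 → 3 := fun h x => by
    rcases (Metric.infDist_nonneg (x := x) (s := (M : Set X))).eq_or_lt with hd | hd
    · refine ⟨x, ?_, by simpa using hd⟩
      exact (hM.mem_iff_infDist_zero ⟨0, M.zero_mem⟩).2 hd.symm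
    · set d := Metric.infDist x (M : Set X)
      have hq : d⁻¹ • M.mkQ x ∈ Metric.closedBall (0 : X ⧸ M) 1 := by
        rw [mem_closedBall_zero_iff, norm_smul, M.norm_mkQ_eq_infDist, norm_inv,
          Real.norm_of_nonneg hd.le, inv_mul_cancel₀ hd.ne']
      rw [← h] at hq
      obtain ⟨z, hz, hzq⟩ := hq
      rw [mem_closedBall_zero_iff] at hz
      have hy : x - d • z ∈ M := by
        rw [← M.ker_mkQ, LinearMap.mem_ker, map_sub, map_smul, hzq, smul_inv_smul₀ hd.ne',
          sub_self]
      refine ⟨x - d • z, hy, le_antisymm ?_ ?_⟩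
      · rw [sub_sub_self, norm_smul, Real.norm_of_nonneg hd.le]
        exact mul_le_of_le_one_right hd.le hz
      · rw [← dist_eq_norm]
        exact Metric.infDist_le_dist_of_mem hy
  tfae_have 3 → 1 := fun h => by
    refine M.mkQ_image_closedBall_subset.antisymm fun q hq => ?_
    obtain ⟨x, rfl⟩ := M.mkQ_surjective q
    obtain ⟨y, hy, hxy⟩ := h x
    rw [mem_closedBall_zero_iff, M.norm_mkQ_eq_infDist, ← hxy] at hq
    refine ⟨x - y, mem_closedBall_zero_iff.2 hq, ?_⟩
    rw [map_sub, sub_eq_self, ← LinearMap.mem_ker, M.ker_mkQ]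
    exact hy
  tfae_finish
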